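/- Let d ≥ 1 and 0 < t < d, and let (U_i)_{i≥1} be measurable subsets of 𝕋^d. If Σ_{i=1}^∞ λ(U_i)^{t/d} = ∞, then Σ_{i=1}^∞ λ(U_i)² / I_t(U_i) = ∞. -/

import Mathlib

open MeasureTheory Filter
open scoped ENNReal

noncomputable section

/-- The `d`-dimensional torus `ℝ^d/ℤ^d`, with its Haar probability measure `volume`. -/
abbrev Torus (d : ℕ) : Type := Fin d → AddCircle (1 : ℝ)

/-- The `t`-energy `I_t(A) = ∬_{A×A} dist(x,y)^{-t} dλ(x) dλ(y)` of a set `A ⊆ 𝕋^d`. -/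
def energy {d : ℕ} (t : ℝ) (A : Set (Torus d)) : ℝ≥0∞ :=
  ∫⁻ x in A, ∫⁻ y in A, edist x y ^ (-t) ∂volume ∂volume

/-- Dyadic majorant of the Riesz kernel `edist x y ^ (-t)` at scale `ρ`. -/
theorem edist_rpow_neg_le_add_tsum {X : Type*} [MetricSpace X] {t ρ : ℝ} (ht : 0 < t)
    (hρ : 0 < ρ) (x y : X) :
    edist x y ^ (-t) ≤ ENNReal.ofReal (ρ ^ (-t)) +
      ∑' k : ℕ, (Metric.closedBall x (ρ * (1 / 2) ^ k)).indicator
        (fun _ => ENNReal.ofReal ((ρ * (1 / 2) ^ (k + 1)) ^ (-t))) y := by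
  rcases eq_or_ne x y with rfl | hxy
  · have h : ∑' _ : ℕ, ENNReal.ofReal (ρ ^ (-t)) = ⊤ :=
      ENNReal.tsum_const_eq_top_of_ne_zero
        (ENNReal.ofReal_pos.2 (Real.rpow_pos_of_pos hρ _)).ne'
    refine le_top.trans (h.symm.le.trans ((ENNReal.tsum_le_tsum fun k => ?_).trans le_add_self))
    rw [Set.indicator_of_mem (Metric.mem_closedBall_self (by positivity))]
    refine ENNReal.ofReal_le_ofReal
      (Real.rpow_le_rpow_of_nonpos (by positivity) ?_ (by linarith))
    exact mul_le_of_le_one_right hρ.le (pow_le_one₀ (by norm_num) (by norm_num))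
  · have hd : 0 < dist x y := dist_pos.2 hxy
    rw [edist_dist, ENNReal.ofReal_rpow_of_pos hd]
    rcases lt_or_ge ρ (dist x y) with h | h
    · exact (ENNReal.ofReal_le_ofReal
        (Real.rpow_le_rpow_of_nonpos hρ h.le (by linarith))).trans le_self_add
    · obtain ⟨k, hk1, hk2⟩ := exists_nat_pow_near_of_lt_one (div_pos hd hρ)
        ((div_le_one hρ).2 h) (by norm_num : (0 : ℝ) < 1 / 2) (by norm_num)
      rw [lt_div_iff₀' hρ] at hk1
      rw [div_le_iff₀' hρ] at hk2
      refine le_trans ?_ ((ENNReal.le_tsum k).trans le_add_self)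
      rw [Set.indicator_of_mem (by rwa [Metric.mem_closedBall, dist_comm])]
      exact ENNReal.ofReal_le_ofReal
        (Real.rpow_le_rpow_of_nonpos (by positivity) hk1.le (by linarith))

theorem Torus.volume_closedBall_le {d : ℕ} (x : Torus d) {r : ℝ} (hr : 0 ≤ r) :
    volume (Metric.closedBall x r) ≤ ENNReal.ofReal ((2 * r) ^ d) := by
  rw [volume_pi_closedBall _ hr]
  simp_rw [AddCircle.volume_closedBall]
  rw [Finset.prod_const, Finset.card_univ, Fintype.card_fin,
    ENNReal.ofReal_pow (by positivity)]
  gcongr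
  exact min_le_right _ _

/-- The Riesz potential of a set of measure `ρ ^ d` in the torus is at most a constant times
`ρ ^ (d - t)`. -/
theorem Torus.exists_setLIntegral_edist_rpow_neg_le {d : ℕ} {t : ℝ} (ht : 0 < t) (htd : t < d) :
    ∃ C : ℝ≥0∞, C ≠ 0 ∧ C ≠ ⊤ ∧ ∀ (A : Set (Torus d)) (x : Torus d) (ρ : ℝ), 0 < ρ →
      volume A = ENNReal.ofReal (ρ ^ d) →
        ∫⁻ y in A, edist x y ^ (-t) ≤ C * ENNReal.ofReal (ρ ^ (d - t)) := by
  set q : ℝ := 2 ^ (t - d) with hq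
  have hq0 : 0 < q := by positivity
  have hq1 : q < 1 := Real.rpow_lt_one_of_one_lt_of_neg (by norm_num) (by linarith)
  have hs : Summable fun k : ℕ => (2 : ℝ) ^ (t + d) * q ^ k :=
    (summable_geometric_of_lt_one hq0.le hq1).mul_left _
  refine ⟨1 + ∑' k : ℕ, ENNReal.ofReal (2 ^ (t + d) * q ^ k),
    (zero_lt_one.trans_le le_self_add).ne',
    ENNReal.add_ne_top.2 ⟨ENNReal.one_ne_top, hs.tsum_ofReal_ne_top⟩,
    fun A x ρ hρ hA => ?_⟩
  refine (lintegral_mono fun y => edist_rpow_neg_le_add_tsum ht hρ x y).trans ?_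
  rw [lintegral_add_left measurable_const, setLIntegral_const,
    lintegral_tsum fun k =>
      (measurable_const.indicator Metric.isClosed_closedBall.measurableSet).aemeasurable,
    add_mul, one_mul, ← ENNReal.tsum_mul_right]
  refine add_le_add (le_of_eq ?_) (ENNReal.tsum_le_tsum fun k => ?_)
  · rw [hA, ← ENNReal.ofReal_mul (by positivity), ← Real.rpow_natCast, ← Real.rpow_add hρ]
    ring_nf
  · rw [lintegral_indicator_const Metric.isClosed_closedBall.measurableSet]
    refine (mul_le_mul_right ((Measure.restrict_apply_le _ _).trans
      (Torus.volume_closedBall_le x (by positivity))) _).trans (le_of_eq ?_)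
    rw [← ENNReal.ofReal_mul (by positivity), ← ENNReal.ofReal_mul (by positivity)]
    congr 1
    have h2 : (0 : ℝ) < 2 := by norm_num
    have e (n : ℕ) : ((1 : ℝ) / 2) ^ n = 2 ^ (-(n : ℝ)) := by
      rw [Real.rpow_neg h2.le, Real.rpow_natCast, one_div, inv_pow]
    rw [e, e, ← Real.rpow_natCast (2 * _) d, ← Real.rpow_natCast q k, hq,
      Real.mul_rpow hρ.le (by positivity), Real.mul_rpow h2.le (by positivity),
      Real.mul_rpow hρ.le (by positivity), ← Real.rpow_mul h2.le, ← Real.rpow_mul h2.le,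
      ← Real.rpow_mul h2.le, sub_eq_add_neg (d : ℝ) t, Real.rpow_add hρ]
    rw [show ρ ^ (-t) * 2 ^ (-((k + 1 : ℕ) : ℝ) * -t) *
        (2 ^ (d : ℝ) * (ρ ^ (d : ℝ) * 2 ^ (-(k : ℝ) * d))) =
        (2 ^ (-((k + 1 : ℕ) : ℝ) * -t) * 2 ^ (d : ℝ) * 2 ^ (-(k : ℝ) * d)) *
        (ρ ^ (d : ℝ) * ρ ^ (-t)) by ring]
    rw [← Real.rpow_add h2, ← Real.rpow_add h2, ← Real.rpow_add h2]
    congr 2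
    push_cast
    ring

/-- The energy of a set of positive measure `v` in `𝕋^d` is at most a constant times
`v ^ (2 - t / d)`. -/
theorem exists_energy_le {d : ℕ} {t : ℝ} (hd : 1 ≤ d) (ht : 0 < t) (htd : t < d) :
    ∃ C : ℝ≥0∞, C ≠ 0 ∧ C ≠ ⊤ ∧ ∀ A : Set (Torus d), volume A ≠ 0 →
      energy t A ≤ C * volume A ^ (1 - t / d) * volume A := by
  obtain ⟨C, hC0, hC, h⟩ := Torus.exists_setLIntegral_edist_rpow_neg_le ht htd
  refine ⟨C, hC0, hC, fun A hA => ?_⟩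
  have hd0 : (d : ℝ) ≠ 0 := by positivity
  have hAt : volume A ≠ ⊤ := measure_ne_top _ _
  have hv : 0 < (volume A).toReal := ENNReal.toReal_pos hA hAt
  have hpow : volume A = ENNReal.ofReal (((volume A).toReal ^ (1 / (d : ℝ))) ^ d) := by
    rw [← Real.rpow_natCast, ← Real.rpow_mul hv.le, one_div_mul_cancel hd0, Real.rpow_one,
      ENNReal.ofReal_toReal hAt]
  have hexp : ENNReal.ofReal (((volume A).toReal ^ (1 / (d : ℝ))) ^ (d - t)) =
      volume A ^ (1 - t / d) := by
    rw [← Real.rpow_mul hv.le, ← ENNReal.ofReal_rpow_of_pos hv, ENNReal.ofReal_toReal hAt]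
    congr 1
    field_simp
  calc energy t A ≤ ∫⁻ _ in A, C * volume A ^ (1 - t / d) :=
        lintegral_mono fun x => hexp ▸ h A x _ (Real.rpow_pos_of_pos hv _) hpow
    _ = C * volume A ^ (1 - t / d) * volume A := setLIntegral_const _ _

/-- If `Σ λ(U_i)^{t/d} = ∞` then `Σ λ(U_i)² / I_t(U_i) = ∞`. -/
theorem tsum_volume_sq_div_energy_eq_top
    (d : ℕ) (hd : 1 ≤ d) (t : ℝ) (ht0 : 0 < t) (htd : t < d)
    (U : ℕ → Set (Torus d)) (hU : ∀ i, MeasurableSet (U i))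
    (hdiv : (∑' i, (volume (U i)) ^ (t / d) : ℝ≥0∞) = ⊤) :
    (∑' i, (volume (U i)) ^ 2 / energy t (U i) : ℝ≥0∞) = ⊤ := by
  obtain ⟨C, hC0, hC, hE⟩ := exists_energy_le hd ht0 htd
  have hle (i : ℕ) : volume (U i) ^ (t / d) ≤ C * (volume (U i) ^ 2 / energy t (U i)) := by
    have hd0 : (0 : ℝ) < d := ht0.trans htd
    rcases eq_or_ne (volume (U i)) 0 with h0 | h0
    · rw [h0, ENNReal.zero_rpow_of_pos (div_pos ht0 hd0)]
      exact zero_le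
    have hUt : volume (U i) ≠ ⊤ := measure_ne_top _ _
    have hEt : energy t (U i) ≠ ⊤ := ne_top_of_le_ne_top
      (ENNReal.mul_ne_top (ENNReal.mul_ne_top hC
        (ENNReal.rpow_ne_top_of_ne_zero h0 hUt)) hUt) (hE (U i) h0)
    rw [← mul_div_assoc]
    refine (ENNReal.le_div_iff_mul_le (Or.inr (mul_ne_zero hC0 (pow_ne_zero 2 h0)))
      (Or.inl hEt)).2 ?_
    calc volume (U i) ^ (t / d) * energy t (U i)
        ≤ volume (U i) ^ (t / d) * (C * volume (U i) ^ (1 - t / d) * volume (U i)) := by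
          gcongr
          exact hE (U i) h0
      _ = C * (volume (U i) ^ (t / d) * volume (U i) ^ (1 - t / d)) * volume (U i) := by ring
      _ = C * volume (U i) ^ 2 := by
          rw [← ENNReal.rpow_add _ _ h0 hUt, add_sub_cancel, ENNReal.rpow_one, mul_assoc, sq]
  have hsum := ENNReal.tsum_le_tsum hle
  rw [hdiv, ENNReal.tsum_mul_left, top_le_iff] at hsum
  by_contra hne
  exact ENNReal.mul_ne_top hC hne hsum
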